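/- arXiv:2604.12029 — 3 statements merged into one kernel-verified Lean document; each statement's English description precedes it below -/
import Mathlib

section
/- Let k ≥ 1 and n ≥ 4. Then γ_{[k]R}(C_9 □ P_n) ≤ 9(n−2)·⌈(k+5)/5⌉ + 18·⌈(k+3−⌈(k+5)/5⌉)/3⌉ − (2n − ⌊n/3⌋). -/
open Finset
open scoped Classical

/-- The cylindrical grid `C_m □ P_n`: the Cartesian (box) product of the
cycle on `m` vertices with the path on `n` vertices. -/
def cylGrid (m n : ℕ) : SimpleGraph (Fin m × Fin n) :=
  (SimpleGraph.cycleGraph m).boxProd (SimpleGraph.pathGraph n)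

/-- `f : V → ℕ` is a `[k]`-Roman dominating function on `G`:
values lie in `{0,…,k+1}`, and every vertex `v` with `f v < k` satisfies
`f(N[v]) ≥ k + |AN(v)|`, where `AN(v)` is the set of neighbors of `v`
with positive label. -/
def IsKRomanDF {V : Type*} [Fintype V] (G : SimpleGraph V) (k : ℕ) (f : V → ℕ) : Prop :=
  (∀ v, f v ≤ k + 1) ∧
  (∀ v, f v < k →
    k + (Finset.univ.filter fun u => G.Adj v u ∧ 0 < f u).card ≤
      f v + ∑ u ∈ Finset.univ.filter (fun u => G.Adj v u), f u)

/-- The `[k]`-Roman domination number: the minimum total weight of a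
`[k]`-Roman dominating function. -/
noncomputable def gammaKR {V : Type*} [Fintype V] (G : SimpleGraph V) (k : ℕ) : ℕ :=
  sInf { w : ℕ | ∃ f : V → ℕ, IsKRomanDF G k f ∧ w = ∑ v, f v }

/-- The packing number: the maximum cardinality of a set of vertices whose
closed neighborhoods are pairwise disjoint. -/
noncomputable def packingNumber {V : Type*} [Fintype V] (G : SimpleGraph V) : ℕ :=
  sSup { w : ℕ | ∃ D : Set V,
    (D.Pairwise fun u v =>
      Disjoint (insert u (G.neighborSet u)) (insert v (G.neighborSet v))) ∧
    w = D.ncard }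

/-- Indicator of a positive label. -/
def posInd (x : ℕ) : ℕ := min x 1

/-- The local condition at the `i`-th vertex of the row `q`, with rows `p` and `s` next to it
(a missing row is represented by the zero row). -/
def okAt (k : ℕ) (p q s : Fin 9 → ℕ) (i : Fin 9) : Prop :=
  q i ≤ k + 1 ∧ (k ≤ q i ∨
    k + (posInd (q (i + 1)) + posInd (q (i - 1)) + posInd (p i) + posInd (s i)) ≤
      q i + (q (i + 1) + q (i - 1) + p i + s i))

instance (k : ℕ) (p q s : Fin 9 → ℕ) (i : Fin 9) : Decidable (okAt k p q s i) := by
  unfold okAt; exact instDecidableAnd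

/-- Rows `1..n` of `F` form a `[k]`-Roman dominating function, rows `0` and `n+1` are padding. -/
def Valid (k n : ℕ) (F : ℕ → Fin 9 → ℕ) : Prop :=
  (∀ i, F 0 i = 0) ∧ (∀ i, F (n + 1) i = 0) ∧
    ∀ j < n, ∀ i, okAt k (F j) (F (j + 1)) (F (j + 2)) i

lemma cycle_adj (x y : Fin 9) :
    (SimpleGraph.cycleGraph 9).Adj x y ↔ (y = x + 1 ∨ y = x - 1) := by
  rw [SimpleGraph.cycleGraph_adj]
  revert x y; decide

/-- Sum over the neighbours of a vertex. -/
lemma sum_nbr (n : ℕ) (φ : ℕ → Fin 9 → ℕ) (h0 : ∀ i, φ 0 i = 0) (h1 : ∀ i, φ (n + 1) i = 0)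
    (i : Fin 9) (j : Fin n) :
    ∑ u ∈ Finset.univ.filter (fun u => (cylGrid 9 n).Adj (i, j) u), φ (u.2.1 + 1) u.1 =
      φ (j + 1) (i + 1) + φ (j + 1) (i - 1) + φ j i + φ (j + 2) i := by
  have hne : i + 1 ≠ i - 1 := by revert i; decide
  have hi1 : i ≠ i + 1 := by revert i; decide
  have hi2 : i ≠ i - 1 := by revert i; decide
  have hn := j.2
  have key : ∀ u : Fin 9 × Fin n,
      (if (cylGrid 9 n).Adj (i, j) u then φ (u.2.1 + 1) u.1 else 0) =
      (if u = (i + 1, j) then φ (j + 1) (i + 1) else 0) +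
      (if u = (i - 1, j) then φ (j + 1) (i - 1) else 0) +
      (if u.1 = i ∧ u.2.1 + 1 = j.1 then φ j i else 0) +
      (if u.1 = i ∧ u.2.1 = j.1 + 1 then φ (j + 2) i else 0) := by
    rintro ⟨x, y⟩
    simp only [cylGrid, SimpleGraph.boxProd_adj, cycle_adj, SimpleGraph.pathGraph_adj,
      Prod.mk.injEq]
    by_cases hy : j = y
    · subst hy
      by_cases hx1 : x = i + 1
      · subst hx1; simp [hne]
      · by_cases hx2 : x = i - 1
        · subst hx2; simp [hne.symm]
        · simp [hx1, hx2]
    · have hy' : ¬ (y = j) := fun h => hy h.symm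
      by_cases hx : i = x
      · subst hx
        by_cases ha : y.1 + 1 = j.1
        · have : ¬ (y.1 = j.1 + 1) := by omega
          simp [hy, hy', ha, this]
        · by_cases hb : y.1 = j.1 + 1
          · have : ¬ (j.1 + 1 + 1 = j.1) := by omega
            simp [hy, hy', hb]
            intro h; omega
          · have hb' : ¬ (j.1 + 1 = y.1) := fun h => hb h.symm
            simp [hy, hy', ha, hb, hb']
      · have hx' : ¬ (x = i) := fun h => hx h.symm
        simp [hy, hy', hx, hx']
  rw [Finset.sum_filter, Finset.sum_congr rfl (fun u _ => key u)]
  simp only [Finset.sum_add_distrib]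
  congr 1
  · congr 1
    · congr 1 <;> simp
    · by_cases hj : j.1 = 0
      · rw [hj]; simp [h0]
      · rw [Finset.sum_eq_single (i, (⟨j.1 - 1, by omega⟩ : Fin n))]
        · simp; intro h; omega
        · rintro ⟨x, y⟩ _ hb
          rw [if_neg]
          rintro ⟨hx, hy⟩
          apply hb
          simp only at hx hy
          ext <;> simp [hx]; omega
        · simp
  · by_cases hj : j.1 + 1 = n
    · rw [show j.1 + 2 = n + 1 by omega]; simp [h1]
    · rw [Finset.sum_eq_single (i, (⟨j.1 + 1, by omega⟩ : Fin n))]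
      · simp
      · rintro ⟨x, y⟩ _ hb
        rw [if_neg]
        rintro ⟨hx, hy⟩
        apply hb
        simp only at hx hy
        ext <;> simp [hx, hy]
      · simp

lemma gamma_le (k n : ℕ) (F : ℕ → Fin 9 → ℕ) (h : Valid k n F) :
    gammaKR (cylGrid 9 n) k ≤ ∑ j ∈ range n, ∑ i, F (j + 1) i := by
  obtain ⟨h0, h1, hok⟩ := h
  apply Nat.sInf_le
  refine ⟨fun u => F (u.2.1 + 1) u.1, ⟨?_, ?_⟩, ?_⟩
  · rintro ⟨i, j⟩
    exact (hok j j.2 i).1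
  · rintro ⟨i, j⟩ hlt
    have hh := (hok j j.2 i).2
    have e1 := sum_nbr n F h0 h1 i j
    have e2 := sum_nbr n (fun j i => posInd (F j i)) (by simp [h0, posInd]) (by simp [h1, posInd])
      i j
    have e3 : (Finset.univ.filter fun u : Fin 9 × Fin n =>
        (cylGrid 9 n).Adj (i, j) u ∧ 0 < F (u.2.1 + 1) u.1).card =
        ∑ u ∈ Finset.univ.filter (fun u => (cylGrid 9 n).Adj (i, j) u),
          posInd (F (u.2.1 + 1) u.1) := by
      rw [← Finset.filter_filter, Finset.card_filter]
      apply Finset.sum_congr rfl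
      intro u _
      unfold posInd
      split_ifs <;> omega
    rw [e3, e1, e2]
    simp only at hlt
    rcases hh with hh | hh
    · omega
    · exact hh
  · rw [Fintype.sum_prod_type_right, ← Fin.sum_univ_eq_sum_range (fun j => ∑ i, F (j + 1) i)]

/-! ### Extending tables with a rotating row -/

/-- A valid labelling in which rows `c, c+1, c+2` are successive rotations by `r`. -/
def RowExt (k n c : ℕ) (r : Fin 9) (w u : ℕ) (F : ℕ → Fin 9 → ℕ) : Prop :=
  Valid k n F ∧ (∀ i, F (c + 1) i = F c (i - r)) ∧ (∀ i, F (c + 2) i = F (c + 1) (i - r)) ∧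
    c + 1 ≤ n ∧ ∑ j ∈ range n, ∑ i, F (j + 1) i = w ∧ ∑ i, F (c + 1) i = u

lemma rotA : ∀ r i : Fin 9, i + 1 - r = i - r + 1 := by decide

lemma rotB : ∀ r i : Fin 9, i - 1 - r = i - r - 1 := by decide

lemma ext_step (k n c : ℕ) (r : Fin 9) (w u : ℕ) (F : ℕ → Fin 9 → ℕ) (h : RowExt k n c r w u F) :
    ∃ G, RowExt k (n + 1) c r (w + u) u G := by
  obtain ⟨⟨h0, h1, hok⟩, hc1, hc2, hcn, hw, hu⟩ := h
  set G : ℕ → Fin 9 → ℕ := fun j i => if j ≤ c + 1 then F j i else F (j - 1) (i - r) with hG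
  have Gle : ∀ j, j ≤ c + 1 → G j = F j := by
    intro j hj; funext i; simp [hG, hj]
  have Gge : ∀ j, c ≤ j → G (j + 1) = fun i => F j (i - r) := by
    intro j hj; funext i
    by_cases hh : j = c
    · subst hh; simp [hG, hc1]
    · have : ¬ (j + 1 ≤ c + 1) := by omega
      simp [hG, this]
  have rot1 : ∀ i : Fin 9, i + 1 - r = i - r + 1 := fun i => rotA r i
  have rot2 : ∀ i : Fin 9, i - 1 - r = i - r - 1 := fun i => rotB r i
  have hsum : ∀ j, ∑ i, F j (i - r) = ∑ i, F j i := fun j =>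
    Equiv.sum_comp (Equiv.subRight r) (F j)
  refine ⟨G, ⟨?_, ?_, ?_⟩, ?_, ?_, by omega, ?_, ?_⟩
  · intro i; rw [Gle 0 (by omega)]; exact h0 i
  · intro i; rw [Gge (n + 1) (by omega)]; exact h1 _
  · intro j hj i
    by_cases hjc : j + 1 ≤ c + 1
    · have e : G (j + 2) = F (j + 2) := by
        by_cases h3 : j + 2 ≤ c + 1
        · exact Gle _ h3
        · have : j = c := by omega
          subst this
          rw [Gge (j + 1) (by omega)]; funext i; exact (hc2 i).symm
      rw [Gle j (by omega), Gle (j + 1) hjc, e]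
      exact hok j (by omega) i
    · obtain ⟨l, rfl⟩ : ∃ l, j = l + 1 := ⟨j - 1, by omega⟩
      have := hok l (by omega) (i - r)
      rw [Gge l (by omega), Gge (l + 1) (by omega), Gge (l + 2) (by omega)]
      unfold okAt at this ⊢
      simpa only [rot1, rot2] using this
  · intro i; rw [Gle c (by omega), Gle (c + 1) le_rfl]; exact hc1 i
  · intro i; rw [Gge (c + 1) (by omega), Gle (c + 1) le_rfl]
  · obtain ⟨m, rfl⟩ : ∃ m, n = c + m := ⟨n - c, by omega⟩
    rw [← hw, ← hu, show c + m + 1 = c + 1 + m by ring, Finset.sum_range_add,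
      Finset.sum_range_add _ c m, Finset.sum_range_succ]
    have a1 : ∑ x ∈ range c, ∑ i, G (x + 1) i = ∑ x ∈ range c, ∑ i, F (x + 1) i := by
      apply Finset.sum_congr rfl
      intro x hx; rw [Gle (x + 1) (by have := Finset.mem_range.1 hx; omega)]
    have a2 : ∑ x ∈ range m, ∑ i, G (c + 1 + x + 1) i = ∑ x ∈ range m, ∑ i, F (c + x + 1) i := by
      apply Finset.sum_congr rfl
      intro x _
      rw [Gge (c + 1 + x) (by omega), hsum, show c + 1 + x = c + x + 1 by ring]
    rw [a1, a2, Gle (c + 1) le_rfl]; ring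
  · rw [Gle (c + 1) le_rfl]; exact hu

lemma ext_gamma (k n c : ℕ) (r : Fin 9) (w u : ℕ) (F : ℕ → Fin 9 → ℕ) (h : RowExt k n c r w u F)
    (m : ℕ) : gammaKR (cylGrid 9 (n + m)) k ≤ w + m * u := by
  have : ∃ G, RowExt k (n + m) c r (w + m * u) u G := by
    induction m with
    | zero => exact ⟨F, by simpa using h⟩
    | succ m ih =>
      obtain ⟨G, hG⟩ := ih
      obtain ⟨G', hG'⟩ := ext_step _ _ _ _ _ _ G hG
      exact ⟨G', by rw [show w + (m + 1) * u = w + m * u + u by ring]; exact hG'⟩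
  obtain ⟨G, hG⟩ := this
  have := gamma_le _ _ G hG.1
  rw [hG.2.2.2.2.1] at this
  exact this

/-- Labelling read off from a table (rows numbered from 1). -/
def tab (T : List (List ℕ)) (j : ℕ) (i : Fin 9) : ℕ := (([] :: T).getD j []).getD i.1 0

def tab2 : ℕ → Fin 9 → ℕ := tab [
  [0, 1, 2, 0, 3, 3, 0, 3, 0],
  [3, 3, 0, 3, 0, 0, 1, 2, 0],
  [0, 0, 1, 2, 0, 3, 3, 0, 3],
  [0, 2, 0, 2, 2, 0, 1, 1, 2]]

def tab5a : ℕ → Fin 9 → ℕ := tab [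
  [5, 0, 5, 0, 2, 0, 5, 1, 0],
  [2, 0, 0, 1, 5, 1, 0, 0, 4],
  [0, 5, 3, 0, 0, 0, 5, 3, 0],
  [3, 0, 0, 4, 2, 2, 3, 0, 4]]

def tab5b : ℕ → Fin 9 → ℕ := tab [
  [5, 0, 2, 4, 0, 4, 0, 4, 0],
  [0, 2, 0, 4, 0, 5, 0, 3, 0],
  [0, 5, 0, 3, 0, 0, 2, 0, 4],
  [0, 0, 2, 0, 4, 0, 5, 0, 3],
  [5, 0, 4, 1, 2, 0, 5, 2, 0]]

def tab6 : ℕ → Fin 9 → ℕ := tab [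
  [4, 2, 3, 3, 2, 3, 0, 4, 0],
  [2, 3, 0, 4, 0, 4, 2, 3, 3],
  [0, 4, 2, 3, 3, 2, 3, 0, 4],
  [2, 3, 0, 4, 3, 0, 4, 0, 4]]

def tab9a : ℕ → Fin 9 → ℕ := tab [
  [0, 3, 4, 0, 10, 0, 0, 5, 5],
  [4, 6, 4, 1, 0, 0, 9, 0, 0],
  [0, 4, 0, 6, 0, 5, 2, 0, 5],
  [0, 6, 0, 5, 1, 5, 0, 5, 6]]

def tab9b : ℕ → Fin 9 → ℕ := tab [
  [4, 5, 1, 6, 0, 5, 0, 8, 0],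
  [2, 5, 0, 7, 0, 5, 0, 3, 0],
  [0, 5, 0, 3, 0, 2, 5, 0, 7],
  [0, 2, 5, 0, 7, 0, 5, 0, 3],
  [8, 2, 5, 0, 6, 0, 5, 5, 0]]

def tab20a : ℕ → Fin 9 → ℕ := tab [
  [0, 8, 10, 0, 13, 0, 13, 0, 12],
  [4, 5, 5, 0, 8, 0, 8, 0, 9],
  [5, 4, 4, 11, 0, 8, 1, 9, 0],
  [10, 8, 1, 10, 0, 13, 0, 12, 0]]

def tab20b : ℕ → Fin 9 → ℕ := tab [
  [0, 0, 11, 0, 11, 10, 0, 0, 21],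
  [0, 11, 10, 0, 0, 0, 13, 0, 0],
  [11, 0, 0, 12, 11, 0, 9, 12, 0],
  [11, 10, 1, 0, 2, 9, 0, 0, 0],
  [0, 1, 11, 10, 0, 11, 5, 10, 11]]

def tab20c : ℕ → Fin 9 → ℕ := tab [
  [8, 3, 11, 9, 0, 0, 15, 6, 0],
  [11, 0, 0, 2, 13, 7, 0, 0, 10],
  [0, 10, 11, 0, 0, 2, 13, 7, 0],
  [7, 0, 0, 10, 11, 0, 0, 2, 13],
  [2, 15, 6, 0, 0, 10, 11, 0, 0],
  [0, 10, 0, 9, 12, 0, 1, 10, 11]]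

lemma ext2 : RowExt 2 4 1 5 46 12 tab2 :=
  ⟨⟨by decide +kernel, by decide +kernel, by decide +kernel⟩, by decide +kernel,
    by decide +kernel, by decide, by decide +kernel, by decide +kernel⟩

lemma ext6 : RowExt 6 4 1 5 83 21 tab6 :=
  ⟨⟨by decide +kernel, by decide +kernel, by decide +kernel⟩, by decide +kernel,
    by decide +kernel, by decide, by decide +kernel, by decide +kernel⟩

lemma ext5 : RowExt 5 5 2 5 80 14 tab5b :=
  ⟨⟨by decide +kernel, by decide +kernel, by decide +kernel⟩, by decide +kernel,
    by decide +kernel, by decide, by decide +kernel, by decide +kernel⟩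

lemma ext9 : RowExt 9 5 2 5 126 22 tab9b :=
  ⟨⟨by decide +kernel, by decide +kernel, by decide +kernel⟩, by decide +kernel,
    by decide +kernel, by decide, by decide +kernel, by decide +kernel⟩

lemma ext20 : RowExt 20 6 2 2 278 43 tab20c :=
  ⟨⟨by decide +kernel, by decide +kernel, by decide +kernel⟩, by decide +kernel,
    by decide +kernel, by decide, by decide +kernel, by decide +kernel⟩

lemma gam5 : gammaKR (cylGrid 9 4) 5 ≤ 65 :=
  (gamma_le 5 4 tab5a ⟨by decide +kernel, by decide +kernel, by decide +kernel⟩).trans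
    (by decide +kernel)

lemma gam9 : gammaKR (cylGrid 9 4) 9 ≤ 101 :=
  (gamma_le 9 4 tab9a ⟨by decide +kernel, by decide +kernel, by decide +kernel⟩).trans
    (by decide +kernel)

lemma gam20a : gammaKR (cylGrid 9 4) 20 ≤ 191 :=
  (gamma_le 20 4 tab20a ⟨by decide +kernel, by decide +kernel, by decide +kernel⟩).trans
    (by decide +kernel)

lemma gam20b : gammaKR (cylGrid 9 5) 20 ≤ 234 :=
  (gamma_le 20 5 tab20b ⟨by decide +kernel, by decide +kernel, by decide +kernel⟩).trans
    (by decide +kernel)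

/-! ### The general construction -/

/-- Sum over the closed neighbourhood. -/
def nsum (H : ℕ → Fin 9 → ℤ) (j : ℕ) (i : Fin 9) : ℤ :=
  H j i + H (j + 1) i + H (j + 1) (i + 1) + H (j + 1) (i - 1) + H (j + 2) i

/-- A strong labelling, obtained from an integer valued one. -/
lemma strong_valid (k n : ℕ) (hn : 2 ≤ n) (H : ℕ → Fin 9 → ℤ) (h0 : ∀ i, H 0 i = 0)
    (h1 : ∀ i, H (n + 1) i = 0) (hpos : ∀ j i, 0 ≤ H j i) (hle : ∀ j i, H j i ≤ k + 1)
    (hN : ∀ j < n, ∀ i, (k : ℤ) + (if j = 0 ∨ j + 1 = n then 3 else 4) ≤ nsum H j i) :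
    Valid k n (fun j i => (H j i).toNat) := by
  refine ⟨by simp [h0], by simp [h1], ?_⟩
  intro j hj i
  have a1 := hpos j i
  have a2 := hpos (j + 1) i
  have a3 := hpos (j + 1) (i + 1)
  have a4 := hpos (j + 1) (i - 1)
  have a5 := hpos (j + 2) i
  have b2 := hle (j + 1) i
  have hh := hN j hj i
  unfold nsum at hh
  refine ⟨by dsimp only; omega, Or.inr ?_⟩
  unfold posInd
  dsimp only
  by_cases c1 : j = 0
  · subst c1
    have := h0 i
    simp only [true_or, if_true] at hh
    omega
  · by_cases c2 : j + 1 = n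
    · have : H (j + 2) i = 0 := by rw [show j + 2 = n + 1 by omega]; exact h1 i
      simp only [c2, or_true, if_true] at hh
      rw [c2] at *
      omega
    · simp only [c1, c2, or_self, if_false] at hh
      omega

/-- The packing pattern: rows carry 2, 2, 1, 2, 2, 1, ... vertices. -/
def pk (j : ℕ) (i : Fin 9) : ℤ :=
  if j % 3 = 0 then (if (i.1 + j / 3) % 9 = 1 then 1 else 0)
  else if j % 3 = 1 then (if (i.1 + j / 3) % 9 = 4 ∨ (i.1 + j / 3) % 9 = 8 then 1 else 0)
  else (if (i.1 + j / 3) % 9 = 2 ∨ (i.1 + j / 3) % 9 = 6 then 1 else 0)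

lemma pk_add (j : ℕ) : pk (j + 27) = pk j := by
  funext i
  unfold pk
  rw [show (j + 27) % 3 = j % 3 by omega,
    show (i.1 + (j + 27) / 3) % 9 = (i.1 + j / 3) % 9 by omega]

lemma pk_nonneg (j : ℕ) (i : Fin 9) : 0 ≤ pk j i := by
  unfold pk; split_ifs <;> norm_num

lemma pk_le (j : ℕ) (i : Fin 9) : pk j i ≤ 1 := by
  unfold pk; split_ifs <;> norm_num

lemma pk_mod (j t : ℕ) : pk (j + t) = pk (j % 27 + t) := by
  have : ∀ q s, pk (s + 27 * q + t) = pk (s + t) := by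
    intro q s
    induction q with
    | zero => rfl
    | succ q ih => rw [← ih, ← pk_add (s + 27 * q + t)]; congr 1; ring
  conv_lhs => rw [← Nat.mod_add_div j 27]
  exact this _ _

lemma pk_nsum (j : ℕ) (i : Fin 9) : nsum pk j i ≤ 1 := by
  have key : ∀ j < 27, ∀ i, nsum pk j i ≤ 1 := by
    unfold nsum pk; decide +kernel
  have := key (j % 27) (Nat.mod_lt _ (by norm_num)) i
  unfold nsum at this ⊢
  rw [pk_mod j 1, pk_mod j 2, show pk j = pk (j % 27) from pk_mod j 0]
  exact this

lemma pk_row (j : ℕ) : ∑ i, pk j i = if j % 3 = 0 then 1 else 2 := by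
  have key : ∀ j < 27, ∑ i, pk j i = if j % 3 = 0 then 1 else 2 := by
    unfold pk; decide +kernel
  have := key (j % 27) (Nat.mod_lt _ (by norm_num))
  rw [show pk j = pk (j % 27) from pk_mod j 0, this, show j % 27 % 3 = j % 3 by omega]

lemma pk_sum (n : ℕ) : ∑ j ∈ range n, ∑ i, pk (j + 1) i = 2 * (n : ℤ) - ((n / 3 : ℕ) : ℤ) := by
  induction n with
  | zero => simp
  | succ n ih =>
    rw [Finset.sum_range_succ, ih, pk_row]
    split_ifs <;> push_cast <;> omega

/-- The packing inside rows `1..n`. -/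
def pkn (n j : ℕ) (i : Fin 9) : ℤ := if 1 ≤ j ∧ j ≤ n then pk j i else 0

lemma pkn_nonneg (n j : ℕ) (i : Fin 9) : 0 ≤ pkn n j i := by
  unfold pkn; split_ifs
  · exact pk_nonneg _ _
  · norm_num

lemma pkn_le_pk (n j : ℕ) (i : Fin 9) : pkn n j i ≤ pk j i := by
  unfold pkn; split_ifs
  · exact le_rfl
  · exact pk_nonneg _ _

lemma pkn_nsum (n j : ℕ) (i : Fin 9) : nsum (pkn n) j i ≤ 1 := by
  refine le_trans ?_ (pk_nsum j i)
  unfold nsum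
  gcongr <;> exact pkn_le_pk _ _ _

lemma pkn_sum (n : ℕ) :
    ∑ j ∈ range n, ∑ i, pkn n (j + 1) i = 2 * (n : ℤ) - ((n / 3 : ℕ) : ℤ) := by
  rw [← pk_sum]
  apply Finset.sum_congr rfl
  intro j hj
  have := Finset.mem_range.1 hj
  apply Finset.sum_congr rfl
  intro i _
  unfold pkn
  rw [if_pos (by omega)]

/-- The boundary correction. -/
def cor (j : ℕ) (i : Fin 9) : ℤ :=
  if j = 1 then (if i.1 % 3 = 2 then 0 else -1)
  else if j = 2 then 1
  else if j = 3 then (if i.1 % 3 = 2 then -1 else 0)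
  else 0

lemma cor_le (j : ℕ) (i : Fin 9) : cor j i ≤ 1 := by
  unfold cor; split_ifs <;> norm_num

lemma cor_ge (j : ℕ) (i : Fin 9) : -1 ≤ cor j i := by
  unfold cor; split_ifs <;> norm_num

lemma cor_nsum (j : ℕ) (i : Fin 9) :
    nsum cor j i ≤ if j = 0 then -1 else if j = 1 then 2 else 0 := by
  by_cases h : j < 4
  · have key : ∀ j < 4, ∀ i, nsum cor j i ≤ if j = 0 then -1 else if j = 1 then 2 else 0 := by
      unfold nsum cor; decide +kernel
    exact key j h i
  · have : ∀ l i, 4 ≤ l → cor l i = 0 := by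
      intro l i hl
      unfold cor
      rw [if_neg (by omega), if_neg (by omega), if_neg (by omega)]
    unfold nsum
    rw [this _ _ (by omega), this _ _ (by omega), this _ _ (by omega), this _ _ (by omega),
      this _ _ (by omega), if_neg (by omega), if_neg (by omega)]
    norm_num

lemma cor_sum (n : ℕ) (hn : 3 ≤ n) : ∑ j ∈ range n, ∑ i, cor (j + 1) i = 0 := by
  obtain ⟨m, rfl⟩ : ∃ m, n = 3 + m := ⟨n - 3, by omega⟩
  rw [Finset.sum_range_add]
  have a : ∑ x ∈ range 3, ∑ i, cor (x + 1) i = 0 := by unfold cor; decide +kernel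
  rw [a]
  have : ∀ x ∈ range m, ∑ i, cor (3 + x + 1) i = 0 := by
    intro x _
    apply Finset.sum_eq_zero
    intro i _
    unfold cor
    rw [if_neg (by omega), if_neg (by omega), if_neg (by omega)]
  rw [Finset.sum_eq_zero this]; rfl

/-- The base labelling. -/
def base (n : ℕ) (a b : ℤ) (j : ℕ) : ℤ :=
  if j = 0 ∨ n < j then 0 else if j = 1 ∨ j = n then b else a

lemma base_out (n : ℕ) (a b : ℤ) (j : ℕ) (h : j = 0 ∨ n < j) : base n a b j = 0 := by
  unfold base; rw [if_pos h]

lemma base_bd (n : ℕ) (a b : ℤ) (j : ℕ) (h' : 1 ≤ j ∧ j ≤ n) (h : j = 1 ∨ j = n) :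
    base n a b j = b := by
  unfold base; rw [if_neg (by omega), if_pos h]

lemma base_in (n : ℕ) (a b : ℤ) (j : ℕ) (h : 2 ≤ j ∧ j < n) : base n a b j = a := by
  unfold base; rw [if_neg (by omega), if_neg (by omega)]

lemma base_edge (n : ℕ) (hn : 4 ≤ n) (a b : ℤ) (j : ℕ) (hj : j < n) (h : j = 0 ∨ j + 1 = n) :
    base n a b j + 3 * base n a b (j + 1) + base n a b (j + 2) = 3 * b + a := by
  rw [base_bd n a b (j + 1) (by omega) (by omega)]
  rcases h with h | h
  · rw [base_out n a b j (by omega), base_in n a b (j + 2) (by omega)]; ring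
  · rw [base_out n a b (j + 2) (by omega), base_in n a b j (by omega)]; ring

lemma base_next (n : ℕ) (hn : 4 ≤ n) (a b : ℤ) (j : ℕ) (hj : j < n) (h : j = 1 ∨ j + 2 = n) :
    base n a b j + 3 * base n a b (j + 1) + base n a b (j + 2) = 4 * a + b := by
  rw [base_in n a b (j + 1) (by omega)]
  rcases h with h | h
  · rw [base_bd n a b j (by omega) (by omega), base_in n a b (j + 2) (by omega)]; ring
  · rw [base_bd n a b (j + 2) (by omega) (by omega), base_in n a b j (by omega)]; ring

lemma base_mid (n : ℕ) (hn : 4 ≤ n) (a b : ℤ) (j : ℕ) (hj : j < n)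
    (h : ¬ (j = 0 ∨ j + 1 = n)) (h' : ¬ (j = 1 ∨ j + 2 = n)) :
    base n a b j + 3 * base n a b (j + 1) + base n a b (j + 2) = 5 * a := by
  rw [base_in n a b (j + 1) (by omega), base_in n a b (j + 2) (by omega),
    base_in n a b j (by omega)]; ring

lemma base_sum (n : ℕ) (hn : 2 ≤ n) (a b : ℤ) :
    ∑ j ∈ range n, ∑ _i : Fin 9, base n a b (j + 1) = 9 * ((n : ℤ) - 2) * a + 18 * b := by
  obtain ⟨m, rfl⟩ : ∃ m, n = m + 1 + 1 := ⟨n - 2, by omega⟩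
  rw [Finset.sum_range_succ, Finset.sum_range_succ']
  have : ∀ x ∈ range m, ∑ _i : Fin 9, base (m + 1 + 1) a b (x + 1 + 1) = 9 * a := by
    intro x hx
    have := Finset.mem_range.1 hx
    unfold base
    rw [if_neg (by omega), if_neg (by omega)]
    simp
  rw [Finset.sum_congr rfl this]
  unfold base
  simp
  ring

/-- The full labelling. -/
def lab (n : ℕ) (a b c : ℤ) (j : ℕ) (i : Fin 9) : ℤ :=
  if j = 0 ∨ n < j then 0 else base n a b j - pkn n j i - c * (cor j i + cor (n + 1 - j) i)

lemma lab_eq (n : ℕ) (hn : 4 ≤ n) (a b c : ℤ) (j : ℕ) (hj : j ≤ n + 1) (i : Fin 9) :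
    lab n a b c j i = base n a b j - pkn n j i - c * (cor j i + cor (n + 1 - j) i) := by
  unfold lab
  split_ifs with h
  · have : j = 0 ∨ j = n + 1 := by omega
    rcases this with rfl | rfl
    · simp [base, pkn, cor]
      rw [if_neg (by omega), if_neg (by omega), if_neg (by omega)]
    · simp [base, pkn, cor]
      rw [if_neg (by omega), if_neg (by omega), if_neg (by omega)]
  · rfl

lemma construct (k n : ℕ) (hn : 4 ≤ n) (a b c : ℤ) (hc : c = 0 ∨ c = 1)
    (h1 : (k : ℤ) + 5 ≤ 5 * a) (h2 : (k : ℤ) + 4 - c ≤ 3 * b + a)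
    (h3 : (k : ℤ) + 5 + 2 * c ≤ 4 * a + b) (ha : 1 + 2 * c ≤ a) (hb : 1 + 2 * c ≤ b)
    (ha' : a + 2 * c ≤ k + 1) (hb' : b + 2 * c ≤ k + 1) :
    (gammaKR (cylGrid 9 n) k : ℤ) ≤
      9 * ((n : ℤ) - 2) * a + 18 * b - (2 * (n : ℤ) - ((n / 3 : ℕ) : ℤ)) := by
  have hpos : ∀ j i, 0 ≤ lab n a b c j i := by
    intro j i
    unfold lab
    split_ifs with h
    · exact le_rfl
    · have e1 := cor_le j i
      have e2 := cor_le (n + 1 - j) i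
      have e3 := (pkn_le_pk n j i).trans (pk_le j i)
      unfold base
      rcases hc with rfl | rfl <;> split_ifs <;> omega
  have hv : Valid k n (fun j i => (lab n a b c j i).toNat) := by
    apply strong_valid k n (by omega)
    · intro i; simp [lab]
    · intro i; simp [lab]
    · exact hpos
    · intro j i
      unfold lab
      split_ifs with h
      · omega
      · have e1 := cor_ge j i
        have e2 := cor_ge (n + 1 - j) i
        have e3 := pkn_nonneg n j i
        unfold base
        rcases hc with rfl | rfl <;> split_ifs <;> omega
    · intro j hj i
      have p := pkn_nsum n j i
      have l := cor_nsum j i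
      have r := cor_nsum (n - 1 - j) i
      unfold nsum at p l r ⊢
      rw [lab_eq n hn a b c j (by omega), lab_eq n hn a b c (j + 1) (by omega),
        lab_eq n hn a b c (j + 1) (by omega), lab_eq n hn a b c (j + 1) (by omega),
        lab_eq n hn a b c (j + 2) (by omega)]
      rw [show n + 1 - j = n - 1 - j + 2 by omega, show n + 1 - (j + 1) = n - 1 - j + 1 by omega,
        show n + 1 - (j + 2) = n - 1 - j by omega]
      have hB0 := base_edge n hn a b j hj
      have hB1 := base_next n hn a b j hj
      have hB2 := base_mid n hn a b j hj
      by_cases q0 : j = 0 ∨ j + 1 = n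
      · have hB := hB0 q0
        rw [if_pos q0]
        have lr : (if j = 0 then (-1 : ℤ) else if j = 1 then 2 else 0) +
            (if n - 1 - j = 0 then (-1 : ℤ) else if n - 1 - j = 1 then 2 else 0) = -1 := by
          split_ifs <;> omega
        rcases hc with rfl | rfl <;> linarith
      · rw [if_neg q0]
        by_cases q1 : j = 1 ∨ j + 2 = n
        · have hB := hB1 q1
          have lr : (if j = 0 then (-1 : ℤ) else if j = 1 then 2 else 0) +
              (if n - 1 - j = 0 then (-1 : ℤ) else if n - 1 - j = 1 then 2 else 0) = 2 := by
            split_ifs <;> omega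
          rcases hc with rfl | rfl <;> linarith
        · have hB := hB2 q0 q1
          have lr : (if j = 0 then (-1 : ℤ) else if j = 1 then 2 else 0) +
              (if n - 1 - j = 0 then (-1 : ℤ) else if n - 1 - j = 1 then 2 else 0) = 0 := by
            split_ifs <;> omega
          rcases hc with rfl | rfl <;> linarith
  have := gamma_le k n _ hv
  have e : ((∑ j ∈ range n, ∑ i, (lab n a b c (j + 1) i).toNat : ℕ) : ℤ) =
      9 * ((n : ℤ) - 2) * a + 18 * b - (2 * (n : ℤ) - ((n / 3 : ℕ) : ℤ)) := by
    push_cast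
    have e1 : ∀ j ∈ range n, ∑ i, ((lab n a b c (j + 1) i).toNat : ℤ) =
        ∑ _i : Fin 9, base n a b (j + 1) - ∑ i, pkn n (j + 1) i -
          c * (∑ i, cor (j + 1) i + ∑ i, cor (n - 1 - j + 1) i) := by
      intro j hj
      have := Finset.mem_range.1 hj
      rw [← Finset.sum_add_distrib, Finset.mul_sum, ← Finset.sum_sub_distrib,
        ← Finset.sum_sub_distrib]
      apply Finset.sum_congr rfl
      intro i _
      rw [Int.toNat_of_nonneg (hpos _ _), lab_eq n hn a b c (j + 1) (by omega),
        show n + 1 - (j + 1) = n - 1 - j + 1 by omega]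
    rw [Finset.sum_congr rfl e1, Finset.sum_sub_distrib, Finset.sum_sub_distrib,
      ← Finset.mul_sum, Finset.sum_add_distrib, base_sum n (by omega), pkn_sum,
      cor_sum n (by omega), Finset.sum_range_reflect (fun j => ∑ i, cor (j + 1) i),
      cor_sum n (by omega)]
    push_cast
    ring
  rw [← e]
  exact_mod_cast this

theorem gammaKR_C9_packing (k n : ℕ) (hk : 1 ≤ k) (hn : 4 ≤ n) :
    (gammaKR (cylGrid 9 n) k : ℤ) ≤
      9 * ((n : ℤ) - 2) * ⌈((k : ℚ) + 5) / 5⌉ +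
        18 * ⌈((k : ℚ) + 3 - ((⌈((k : ℚ) + 5) / 5⌉ : ℤ) : ℚ)) / 3⌉ -
          (2 * (n : ℤ) - ⌊(n : ℚ) / 3⌋) := by
  have hfl : ⌊(n : ℚ) / 3⌋ = ((n / 3 : ℕ) : ℤ) := by
    rw [Int.floor_eq_iff]
    have h1 : 3 * (n / 3) ≤ n := by omega
    have h2 : n < 3 * (n / 3) + 3 := by omega
    have h1' : (3 : ℚ) * ((n / 3 : ℕ) : ℚ) ≤ n := by exact_mod_cast h1
    have h2' : (n : ℚ) < 3 * ((n / 3 : ℕ) : ℚ) + 3 := by exact_mod_cast h2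
    rw [Int.cast_natCast]
    constructor <;> linarith
  obtain ⟨a, haeq⟩ : ∃ a : ℤ, a = ⌈((k : ℚ) + 5) / 5⌉ := ⟨_, rfl⟩
  rw [← haeq]
  obtain ⟨b, hbeq⟩ : ∃ b : ℤ, b = ⌈((k : ℚ) + 3 - (a : ℚ)) / 3⌉ := ⟨_, rfl⟩
  rw [← hbeq, hfl]
  have ha := Int.ceil_eq_iff.1 haeq.symm
  have hb := Int.ceil_eq_iff.1 hbeq.symm
  have ha1 : (k : ℤ) + 5 ≤ 5 * a := by
    have : (k : ℚ) + 5 ≤ 5 * a := by linarith [ha.2]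
    exact_mod_cast this
  have ha2 : 5 * a ≤ (k : ℤ) + 9 := by
    have : 5 * (a : ℚ) < k + 10 := by linarith [ha.1]
    have : 5 * a < (k : ℤ) + 10 := by exact_mod_cast this
    omega
  have hb1 : (k : ℤ) + 3 ≤ 3 * b + a := by
    have : (k : ℚ) + 3 ≤ 3 * b + a := by linarith [hb.2]
    exact_mod_cast this
  have hb2 : 3 * b + a ≤ (k : ℤ) + 5 := by
    have : 3 * (b : ℚ) + a < k + 6 := by linarith [hb.1]
    have : 3 * b + a < (k : ℤ) + 6 := by exact_mod_cast this
    omega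
  clear ha hb haeq hbeq hfl
  by_cases h0 : (k : ℤ) + 4 ≤ 3 * b + a
  · exact construct k n hn a b 0 (Or.inl rfl) ha1 (by omega) (by omega) (by omega) (by omega)
      (by omega) (by omega)
  by_cases hs : k = 2 ∨ k = 5 ∨ k = 6 ∨ k = 9 ∨ k = 20
  · rcases hs with rfl | rfl | rfl | rfl | rfl
    · obtain ⟨m, rfl⟩ : ∃ m, n = 4 + m := ⟨n - 4, by omega⟩
      have := ext_gamma _ _ _ _ _ _ _ ext2 m
      obtain rfl : a = 2 := by omega
      obtain rfl : b = 1 := by omega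
      push_cast at *
      omega
    · obtain rfl : a = 2 := by omega
      obtain rfl : b = 2 := by omega
      by_cases h4 : n = 4
      · subst h4
        have := gam5
        push_cast at *
        omega
      obtain ⟨m, rfl⟩ : ∃ m, n = 5 + m := ⟨n - 5, by omega⟩
      have := ext_gamma _ _ _ _ _ _ _ ext5 m
      push_cast at *
      omega
    · obtain ⟨m, rfl⟩ : ∃ m, n = 4 + m := ⟨n - 4, by omega⟩
      have := ext_gamma _ _ _ _ _ _ _ ext6 m
      obtain rfl : a = 3 := by omega
      obtain rfl : b = 2 := by omega
      push_cast at *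
      omega
    · obtain rfl : a = 3 := by omega
      obtain rfl : b = 3 := by omega
      by_cases h4 : n = 4
      · subst h4
        have := gam9
        push_cast at *
        omega
      obtain ⟨m, rfl⟩ : ∃ m, n = 5 + m := ⟨n - 5, by omega⟩
      have := ext_gamma _ _ _ _ _ _ _ ext9 m
      push_cast at *
      omega
    · obtain rfl : a = 5 := by omega
      obtain rfl : b = 6 := by omega
      by_cases h4 : n = 4
      · subst h4
        have := gam20a
        push_cast at *
        omega
      by_cases h5 : n = 5
      · subst h5
        have := gam20b
        push_cast at *
        omega
      obtain ⟨m, rfl⟩ : ∃ m, n = 6 + m := ⟨n - 6, by omega⟩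
      have := ext_gamma _ _ _ _ _ _ _ ext20 m
      push_cast at *
      omega
  · have hfacts : (k : ℤ) + 7 ≤ 4 * a + b ∧ 3 ≤ a ∧ 3 ≤ b ∧ a + 2 ≤ k + 1 ∧ b + 2 ≤ k + 1 := by
      by_cases h36 : k < 36
      · interval_cases k <;> first | (exfalso; omega) | (push_cast at *; omega)
      · omega
    obtain ⟨f1, f2, f3, f4, f5⟩ := hfacts
    exact construct k n hn a b 1 (Or.inr rfl) ha1 (by omega) (by omega) (by omega) (by omega)
      (by omega) (by omega)
end

section
/- Let k ≥ 1, t ≥ 1, and n ≥ 2. Then γ_{[k]R}(C_{5t} □ P_n) ≤ t(n(k+1) + 2k). -/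
open Finset
open scoped Classical

theorem aux_sum (a c t : ℕ) :
    ∑ i ∈ Finset.range (5 * t), (if (i + c) % 5 = 0 then a else 0) = t * a := by
  induction t with
  | zero => simp
  | succ t ih =>
    have e : 5 * (t + 1) = 5 * t + 1 + 1 + 1 + 1 + 1 := by ring
    rw [e, Finset.sum_range_succ, Finset.sum_range_succ, Finset.sum_range_succ,
      Finset.sum_range_succ, Finset.sum_range_succ, ih, add_mul, one_mul]
    split_ifs <;> omega

theorem aux_sum_fin (a c t : ℕ) :
    ∑ i : Fin (5 * t), (if (i.val + c) % 5 = 0 then a else 0) = t * a := by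
  rw [Fin.sum_univ_eq_sum_range (fun i => if (i + c) % 5 = 0 then a else 0)]
  exact aux_sum a c t

/-- A vertex adjacent to a vertex of label `k+1` satisfies the domination condition. -/
theorem aux_dom {V : Type*} [Fintype V] (G : SimpleGraph V) (k : ℕ) (f : V → ℕ) (v u : V)
    (h : G.Adj v u) (hu : f u = k + 1) :
    k + (Finset.univ.filter fun u => G.Adj v u ∧ 0 < f u).card ≤
      f v + ∑ u ∈ Finset.univ.filter (fun u => G.Adj v u), f u := by
  have hmem : u ∈ Finset.univ.filter (fun u => G.Adj v u) := by simp [h]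
  have h1 : (Finset.univ.filter fun u => G.Adj v u ∧ 0 < f u).card
      = ∑ u ∈ Finset.univ.filter (fun u => G.Adj v u), (if 0 < f u then 1 else 0) := by
    rw [← Finset.filter_filter, Finset.card_filter]
  rw [h1, ← Finset.add_sum_erase _ _ hmem, ← Finset.add_sum_erase _ f hmem, hu]
  have h2 : ∑ u ∈ (Finset.univ.filter (fun u => G.Adj v u)).erase u,
      (if 0 < f u then 1 else 0) ≤
      ∑ u ∈ (Finset.univ.filter (fun u => G.Adj v u)).erase u, f u := by
    apply Finset.sum_le_sum
    intro x _
    split_ifs <;> omega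
  rw [if_pos (Nat.succ_pos k)]
  omega

/-- The labelling: a perfect code with label `k+1`, plus label `k` on the boundary vertices
left undominated. -/
def auxF (k t n : ℕ) (v : Fin (5 * t) × Fin n) : ℕ :=
  (if (v.1.val + 2 * v.2.val) % 5 = 0 then k + 1 else 0)
    + (if v.2.val = 0 then (if (v.1.val + 3) % 5 = 0 then k else 0) else 0)
    + (if v.2.val = n - 1 then (if (v.1.val + 2 * n) % 5 = 0 then k else 0) else 0)

theorem auxF_sum (k t n : ℕ) (hn : 2 ≤ n) :
    ∑ v, auxF k t n v = t * (n * (k + 1) + 2 * k) := by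
  unfold auxF
  rw [Fintype.sum_prod_type_right]
  simp only [Finset.sum_add_distrib, aux_sum_fin]
  have h2 : ∀ y : Fin n, ∑ x : Fin (5 * t),
      (if y.val = 0 then (if (x.val + 3) % 5 = 0 then k else 0) else 0)
      = if y = ⟨0, by omega⟩ then t * k else 0 := by
    intro y
    by_cases h : y.val = 0
    · simp only [h, if_true, aux_sum_fin, Fin.ext_iff]
    · simp [h, Fin.ext_iff]
  have h3 : ∀ y : Fin n, ∑ x : Fin (5 * t),
      (if y.val = n - 1 then (if (x.val + 2 * n) % 5 = 0 then k else 0) else 0)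
      = if y = ⟨n - 1, by omega⟩ then t * k else 0 := by
    intro y
    by_cases h : y.val = n - 1
    · simp only [h, if_true, aux_sum_fin, Fin.ext_iff]
    · simp [h, Fin.ext_iff]
  simp only [h2, h3, Finset.sum_ite_eq', Finset.mem_univ, if_true, Finset.sum_const,
    Finset.card_univ, Fintype.card_fin, smul_eq_mul]
  ring

theorem aux_cyc (m : ℕ) (a b : Fin m) (hm : 5 ≤ m)
    (h : a.val + 1 = b.val ∨ (a.val + 1 = m ∧ b.val = 0)) :
    (SimpleGraph.cycleGraph m).Adj a b := by
  rw [SimpleGraph.cycleGraph_adj']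
  right
  rw [Fin.sub_def]
  show (m - a.val + b.val) % m = 1
  rcases h with h | ⟨h, h'⟩
  · have : m - a.val + b.val = m + 1 := by omega
    rw [this, Nat.add_mod_left, Nat.mod_eq_of_lt (by omega)]
  · rw [Nat.mod_eq_of_lt (by omega)]; omega

theorem auxF_eq (k t n : ℕ) (hn : 2 ≤ n) (v : Fin (5 * t) × Fin n)
    (h : (v.1.val + 2 * v.2.val) % 5 = 0) : auxF k t n v = k + 1 := by
  unfold auxF
  split_ifs <;> omega

theorem auxF_isDF (k t n : ℕ) (ht : 1 ≤ t) (hn : 2 ≤ n) :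
    IsKRomanDF (cylGrid (5 * t) n) k (auxF k t n) := by
  constructor
  · intro v
    unfold auxF
    split_ifs <;> omega
  · rintro ⟨i, j⟩ hv
    have hi := i.isLt
    have hj := j.isLt
    suffices h : ∃ u, (cylGrid (5 * t) n).Adj (i, j) u ∧ (u.1.val + 2 * u.2.val) % 5 = 0 by
      obtain ⟨u, h1, h2⟩ := h
      exact aux_dom _ k _ _ u h1 (auxF_eq k t n hn u h2)
    have hr : (i.val + 2 * j.val) % 5 < 5 := Nat.mod_lt _ (by norm_num)
    have key : ((i.val + 2 * j.val) % 5 = 1) ∨ ((i.val + 2 * j.val) % 5 = 4) ∨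
        ((i.val + 2 * j.val) % 5 = 2 ∧ j.val ≠ 0) ∨
        ((i.val + 2 * j.val) % 5 = 3 ∧ j.val + 1 < n) := by
      unfold auxF at hv
      dsimp only at hv
      split_ifs at hv <;> omega
    rcases key with h | h | ⟨h, h'⟩ | ⟨h, h'⟩
    · by_cases h0 : i.val = 0
      · refine ⟨(⟨5 * t - 1, by omega⟩, j), ?_, ?_⟩
        · refine SimpleGraph.boxProd_adj.2 (Or.inl ⟨(aux_cyc _ _ _ (by omega) ?_).symm, rfl⟩)
          dsimp only
          omega
        · dsimp only
          omega
      · refine ⟨(⟨i.val - 1, by omega⟩, j), ?_, ?_⟩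
        · refine SimpleGraph.boxProd_adj.2 (Or.inl ⟨(aux_cyc _ _ _ (by omega) ?_).symm, rfl⟩)
          dsimp only
          omega
        · dsimp only
          omega
    · by_cases h0 : i.val + 1 = 5 * t
      · refine ⟨(⟨0, by omega⟩, j), ?_, ?_⟩
        · refine SimpleGraph.boxProd_adj.2 (Or.inl ⟨aux_cyc _ _ _ (by omega) ?_, rfl⟩)
          dsimp only
          omega
        · dsimp only
          omega
      · refine ⟨(⟨i.val + 1, by omega⟩, j), ?_, ?_⟩
        · refine SimpleGraph.boxProd_adj.2 (Or.inl ⟨aux_cyc _ _ _ (by omega) ?_, rfl⟩)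
          dsimp only
          omega
        · dsimp only
          omega
    · refine ⟨(i, ⟨j.val - 1, by omega⟩), ?_, ?_⟩
      · refine SimpleGraph.boxProd_adj.2 (Or.inr ⟨SimpleGraph.pathGraph_adj.2 ?_, rfl⟩)
        dsimp only
        omega
      · dsimp only
        omega
    · refine ⟨(i, ⟨j.val + 1, h'⟩), ?_, ?_⟩
      · refine SimpleGraph.boxProd_adj.2 (Or.inr ⟨SimpleGraph.pathGraph_adj.2 ?_, rfl⟩)
        dsimp only
        omega
      · dsimp only
        omega

theorem gammaKR_C5t (k t n : ℕ) (hk : 1 ≤ k) (ht : 1 ≤ t) (hn : 2 ≤ n) :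
    gammaKR (cylGrid (5 * t) n) k ≤ t * (n * (k + 1) + 2 * k) := by
  exact Nat.sInf_le ⟨auxF k t n, auxF_isDF k t n ht hn, (auxF_sum k t n hn).symm⟩
end

section
/- Let m ≥ 3 and n ≥ 4. Then the double Roman domination number satisfies: if m ≡ 0 (mod 5), γ_{[2]R}(C_m □ P_n) ≤ (m/5)(3n+4); if m ≡ 1 (mod 5), γ_{[2]R}(C_m □ P_n) ≤ ((m+4)/5)(3n+4) − 9 − 8⌊(n−2)/5⌋; if m ≡ 2 (mod 5), γ_{[2]R}(C_m □ P_n) ≤ ((m+3)/5)(3n+4) − 6 − 5⌊(n−2)/5⌋; if m ≡ 3 (mod 5), γ_{[2]R}(C_m □ P_n) ≤ ((m+2)/5)(3n+4) − 4 − 2⌊(n−2)/5⌋; if m ≡ 4 (mod 5), γ_{[2]R}(C_m □ P_n) ≤ ((m+1)/5)(3n+4) − 4. -/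
open Finset
open scoped Classical

/-- Entry `(i, j)` of a table whose rows are stored as decimal numerals
(column `j` is the digit of weight `10 ^ j`). -/
def ent (T : List ℕ) (i j : ℕ) : ℕ := (T.getD i 0) / 10 ^ j % 10

/-- Cyclic successor and predecessor on `{0, …, m - 1}`. -/
def cyS (m i : ℕ) : ℕ := if i + 1 = m then 0 else i + 1
def cyP (m i : ℕ) : ℕ := if i = 0 then m - 1 else i - 1

/-- Local double Roman condition for a label `v` with neighbouring labels `a b c d`. -/
def cellOK (v a b c d : ℕ) : Bool :=
  v == 2 || v == 3 || (v == 0 && Nat.ble 2 ((a - 1) + (b - 1) + (c - 1) + (d - 1)))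

/-- Label to the left / right of column `j` (zero outside the grid). -/
def lft (g : ℕ → ℕ) (j : ℕ) : ℕ := if j = 0 then 0 else g (j - 1)
def rgt (n : ℕ) (g : ℕ → ℕ) (j : ℕ) : ℕ := if j + 1 = n then 0 else g (j + 1)

/-- Folding map: the block of length five starting at `a` occurs `k` times. -/
def fld (a k j : ℕ) : ℕ :=
  if j < a then j else if j < a + 5 * k then a + (j - a) % 5 else j + 5 - 5 * k

/-- Sum of `h 0, …, h (r - 1)` by structural recursion. -/
def sm (h : ℕ → ℕ) : ℕ → ℕ
  | 0 => 0
  | r + 1 => sm h r + h r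

/-- Weight of a row outside of the repeated block, and inside of it. -/
def wOut (N : ℕ) (T : List ℕ) (i : ℕ) : ℕ :=
  sm (ent T i) 2 + sm (fun t => ent T i (7 + t)) (N - 2)
def wIn (T : List ℕ) (i : ℕ) : ℕ := sm (fun t => ent T i (2 + t)) 5

/-- The finite check of a table with `m + 5` rows and `N + 5` columns. -/
def chk (m N A B C D : ℕ) (T : List ℕ) : Bool :=
  ((List.range (m + 5)).all fun i => (List.range (N + 5)).all fun j =>
    cellOK (ent T i j) (ent T (cyS (m + 5) i) j) (ent T (cyP (m + 5) i) j)
      (lft (ent T i) j) (rgt (N + 5) (ent T i) j)) &&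
  ((List.range (N + 5)).all fun j =>
    ent T 0 j == ent T m j && ent T (m - 1) j == ent T (m + 4) j) &&
  ((List.range (m + 5)).all fun i =>
    ent T i 1 == ent T i 6 && ent T i 2 == ent T i 7) &&
  Nat.ble (sm (wOut N T) m) A && Nat.ble (sm (wIn T) m) B &&
  Nat.ble (sm (fun t => wOut N T (m + t)) 5) C && Nat.ble (sm (fun t => wIn T (m + t)) 5) D

theorem sm_eq (h : ℕ → ℕ) (r : ℕ) : sm h r = ∑ i ∈ range r, h i := by
  induction r with
  | zero => simp [sm]
  | succ r ih => rw [sm, ih, sum_range_succ]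

theorem sum_mod_five (h : ℕ → ℕ) (k : ℕ) :
    ∑ x ∈ range (5 * k), h (x % 5) = k * ∑ x ∈ range 5, h x := by
  induction k with
  | zero => simp
  | succ k ih =>
    rw [show 5 * (k + 1) = 5 * k + 5 by ring, sum_range_add, ih]
    have : ∑ x ∈ range 5, h ((5 * k + x) % 5) = ∑ x ∈ range 5, h x := by
      refine sum_congr rfl fun x hx => ?_
      have := mem_range.1 hx
      congr 1; omega
    rw [this]; ring

theorem sum_fld (h : ℕ → ℕ) (a b k : ℕ) :
    ∑ j ∈ range (a + 5 * k + b), h (fld a k j) =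
      ∑ j ∈ range a, h j + k * ∑ t ∈ range 5, h (a + t) + ∑ t ∈ range b, h (a + 5 + t) := by
  rw [sum_range_add, sum_range_add]
  congr 1
  · congr 1
    · refine sum_congr rfl fun j hj => ?_
      have := mem_range.1 hj
      simp [fld, this]
    · rw [← sum_mod_five (fun t => h (a + t))]
      refine sum_congr rfl fun j hj => ?_
      have := mem_range.1 hj
      congr 1
      unfold fld
      rw [if_neg (by omega), if_pos (by omega)]
      congr 1; congr 1; omega
  · refine sum_congr rfl fun j hj => ?_
    congr 1
    unfold fld
    rw [if_neg (by omega), if_neg (by omega)]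
    omega

/-- The sum over the neighbours in the cylinder dominates the sum over the four
explicit neighbours. -/
theorem nbr_sum (m n : ℕ) (hm : 3 ≤ m) (h : ℕ → ℕ → ℕ) (v : Fin m × Fin n) :
    h (cyS m v.1) v.2 + h (cyP m v.1) v.2 +
      (if (v.2 : ℕ) = 0 then 0 else h v.1 (v.2 - 1)) +
      (if (v.2 : ℕ) + 1 = n then 0 else h v.1 (v.2 + 1)) ≤
    ∑ u ∈ univ.filter (fun u => (cylGrid m n).Adj v u), h u.1 u.2 := by
  obtain ⟨⟨i, hi⟩, ⟨j, hj⟩⟩ := v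
  simp only
  have hS : cyS m i < m := by unfold cyS; split_ifs <;> omega
  have hP : cyP m i < m := by unfold cyP; split_ifs <;> omega
  have hSi : cyS m i ≠ i := by unfold cyS; split_ifs <;> omega
  have hPi : cyP m i ≠ i := by unfold cyP; split_ifs <;> omega
  have hSP : cyS m i ≠ cyP m i := by unfold cyS cyP; split_ifs <;> omega
  obtain ⟨M, rfl⟩ : ∃ M, m = M + 1 := ⟨m - 1, by omega⟩
  have aS : (SimpleGraph.cycleGraph (M + 1)).Adj ⟨i, hi⟩ ⟨cyS (M + 1) i, hS⟩ := by
    rw [SimpleGraph.cycleGraph_adj']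
    right
    rw [Fin.sub_def]
    simp only [cyS]
    split_ifs with h1
    · rw [show M + 1 - i + 0 = 1 by omega]; exact Nat.mod_eq_of_lt (by omega)
    · rw [show M + 1 - i + (i + 1) = 1 + (M + 1) by omega, Nat.add_mod_right]
      exact Nat.mod_eq_of_lt (by omega)
  have aP : (SimpleGraph.cycleGraph (M + 1)).Adj ⟨i, hi⟩ ⟨cyP (M + 1) i, hP⟩ := by
    rw [SimpleGraph.cycleGraph_adj']
    left
    rw [Fin.sub_def]
    simp only [cyP]
    split_ifs with h1
    · rw [show M + 1 - (M + 1 - 1) + i = 1 by omega]; exact Nat.mod_eq_of_lt (by omega)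
    · rw [show M + 1 - (i - 1) + i = 1 + (M + 1) by omega, Nat.add_mod_right]
      exact Nat.mod_eq_of_lt (by omega)
  -- the four summands as sums over disjoint finite sets
  let s1 : Finset (Fin (M + 1) × Fin n) := {(⟨cyS (M + 1) i, hS⟩, ⟨j, hj⟩)}
  let s2 : Finset (Fin (M + 1) × Fin n) := {(⟨cyP (M + 1) i, hP⟩, ⟨j, hj⟩)}
  let s3 : Finset (Fin (M + 1) × Fin n) :=
    if j = 0 then ∅ else {(⟨i, hi⟩, ⟨j - 1, by omega⟩)}
  let s4 : Finset (Fin (M + 1) × Fin n) :=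
    if h4 : j + 1 = n then ∅ else {(⟨i, hi⟩, ⟨j + 1, by omega⟩)}
  have d12 : Disjoint s1 s2 := by
    simp only [s1, s2, disjoint_singleton, ne_eq, Prod.mk.injEq, Fin.mk.injEq]; tauto
  have d123 : Disjoint (s1 ∪ s2) s3 := by
    simp only [s1, s2, s3]
    split_ifs
    · simp
    · simp [Ne.symm hSi, Ne.symm hPi]
  have d1234 : Disjoint (s1 ∪ s2 ∪ s3) s4 := by
    simp only [s1, s2, s3, s4]
    split_ifs
    · simp
    · simp [Ne.symm hSi, Ne.symm hPi]
    · simp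
    · simp [Ne.symm hSi, Ne.symm hPi]
      omega
  have hsub : s1 ∪ s2 ∪ s3 ∪ s4 ⊆
      univ.filter (fun u => (cylGrid (M + 1) n).Adj (⟨i, hi⟩, ⟨j, hj⟩) u) := by
    have key : ∀ u, u ∈ s1 ∪ s2 ∪ s3 ∪ s4 →
        (cylGrid (M + 1) n).Adj (⟨i, hi⟩, ⟨j, hj⟩) u := by
      intro u hu
      rw [cylGrid, SimpleGraph.boxProd_adj]
      simp only [mem_union] at hu
      rcases hu with ((hu | hu) | hu) | hu
      · rw [mem_singleton.1 hu]; left; exact ⟨aS, rfl⟩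
      · rw [mem_singleton.1 hu]; left; exact ⟨aP, rfl⟩
      · simp only [s3] at hu
        split_ifs at hu with h3
        · simp at hu
        · rw [mem_singleton.1 hu]; right
          refine ⟨?_, rfl⟩
          rw [SimpleGraph.pathGraph_adj]; right; simp only; omega
      · simp only [s4] at hu
        split_ifs at hu with h3
        · simp at hu
        · rw [mem_singleton.1 hu]; right
          refine ⟨?_, rfl⟩
          rw [SimpleGraph.pathGraph_adj]; left; rfl
    intro u hu
    exact mem_filter.2 ⟨mem_univ _, key u hu⟩
  refine le_trans (le_of_eq ?_) (sum_le_sum_of_subset hsub)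
  rw [sum_union d1234, sum_union d123, sum_union d12]
  refine congrArg₂ _ (congrArg₂ _ (congrArg₂ _ ?_ ?_) ?_) ?_
  · rw [sum_singleton]
  · rw [sum_singleton]
  · simp only [s3]; split_ifs <;> simp
  · simp only [s4]; split_ifs <;> simp

/-- A labelling which satisfies the local condition everywhere bounds the double Roman
domination number. -/
theorem gamma_le_s19 (m n : ℕ) (hm : 3 ≤ m) (g : ℕ → ℕ → ℕ)
    (hg : ∀ i < m, ∀ j < n, cellOK (g i j) (g (cyS m i) j) (g (cyP m i) j)
      (lft (g i) j) (rgt n (g i) j) = true) :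
    gammaKR (cylGrid m n) 2 ≤ ∑ i ∈ range m, ∑ j ∈ range n, g i j := by
  refine Nat.sInf_le ⟨fun v => g v.1 v.2, ⟨?_, ?_⟩, ?_⟩
  · intro v
    have := hg v.1 v.1.2 v.2 v.2.2
    simp only [cellOK, Bool.or_eq_true, Bool.and_eq_true, beq_iff_eq, Nat.ble_eq] at this
    show g v.1 v.2 ≤ 3
    omega
  · intro v hv
    have h1 := hg v.1 v.1.2 v.2 v.2.2
    simp only [cellOK, Bool.or_eq_true, Bool.and_eq_true, beq_iff_eq, Nat.ble_eq] at h1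
    simp only at hv
    have h2 := nbr_sum m n hm (fun i j => g i j - 1) v
    have h3 : ∑ u ∈ univ.filter (fun u => (cylGrid m n).Adj v u), g u.1 u.2 =
        ∑ u ∈ univ.filter (fun u => (cylGrid m n).Adj v u), (g u.1 u.2 - 1) +
        (univ.filter fun u => (cylGrid m n).Adj v u ∧ 0 < g u.1 u.2).card := by
      rw [← filter_filter, card_filter, ← sum_add_distrib]
      refine sum_congr rfl fun u _ => ?_
      split_ifs <;> omega
    beta_reduce
    rw [h3]
    have h4 : lft (g v.1) v.2 - 1 = if (v.2 : ℕ) = 0 then 0 else g v.1 (v.2 - 1) - 1 := by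
      unfold lft; split_ifs <;> rfl
    have h5 : rgt n (g v.1) v.2 - 1 =
        if (v.2 : ℕ) + 1 = n then 0 else g v.1 (v.2 + 1) - 1 := by
      unfold rgt; split_ifs <;> rfl
    rw [h4, h5] at h1
    omega
  · rw [Fintype.sum_prod_type, sum_range]
    refine sum_congr rfl fun i _ => ?_
    rw [sum_range]

theorem table_bound (m N l k A B C D : ℕ) (T : List ℕ) (hm : 3 ≤ m) (hN : 4 ≤ N)
    (h : chk m N A B C D T = true) :
    gammaKR (cylGrid (m + 5 * l) (N + 5 * k)) 2 ≤ A + k * B + l * (C + k * D) := by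
  simp only [chk, Bool.and_eq_true, List.all_eq_true, List.mem_range, beq_iff_eq,
    Nat.ble_eq] at h
  obtain ⟨⟨⟨⟨⟨⟨hcell, hrow⟩, hcol⟩, hA⟩, hB⟩, hC⟩, hD⟩ := h
  have hb : ∀ j < N + 5 * k, fld 2 k j < N + 5 := by
    intro j hj; unfold fld; split_ifs <;> omega
  have ha : ∀ i < m + 5 * l, fld m l i < m + 5 := by
    intro i hi; unfold fld; split_ifs <;> omega
  refine (gamma_le_s19 (m + 5 * l) (N + 5 * k) (by omega)
    (fun i j => ent T (fld m l i) (fld 2 k j)) ?_).trans ?_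
  · intro i hi j hj
    have hc := hcell _ (ha i hi) _ (hb j hj)
    have e1 : ent T (fld m l (cyS (m + 5 * l) i)) (fld 2 k j) =
        ent T (cyS (m + 5) (fld m l i)) (fld 2 k j) := by
      have hr := (hrow _ (hb j hj)).1
      have : fld m l (cyS (m + 5 * l) i) = cyS (m + 5) (fld m l i) ∨
          (fld m l (cyS (m + 5 * l) i) = 0 ∧ cyS (m + 5) (fld m l i) = m) ∨
          (fld m l (cyS (m + 5 * l) i) = m ∧ cyS (m + 5) (fld m l i) = 0) := by
        unfold cyS fld
        split_ifs <;> omega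
      rcases this with h | ⟨h, hpp⟩ | ⟨h, hpp⟩
      · rw [h]
      · rw [h, hpp, hr]
      · rw [h, hpp, hr]
    have e2 : ent T (fld m l (cyP (m + 5 * l) i)) (fld 2 k j) =
        ent T (cyP (m + 5) (fld m l i)) (fld 2 k j) := by
      have hr := (hrow _ (hb j hj)).2
      have : fld m l (cyP (m + 5 * l) i) = cyP (m + 5) (fld m l i) ∨
          (fld m l (cyP (m + 5 * l) i) = m - 1 ∧ cyP (m + 5) (fld m l i) = m + 4) ∨
          (fld m l (cyP (m + 5 * l) i) = m + 4 ∧ cyP (m + 5) (fld m l i) = m - 1) := by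
        unfold cyP fld
        split_ifs <;> omega
      rcases this with h | ⟨h, hpp⟩ | ⟨h, hpp⟩
      · rw [h]
      · rw [h, hpp, hr]
      · rw [h, hpp, hr]
    have hk := hcol _ (ha i hi)
    have e3 : lft (fun j => ent T (fld m l i) (fld 2 k j)) j =
        lft (ent T (fld m l i)) (fld 2 k j) := by
      have : (j = 0 ∧ fld 2 k j = 0) ∨ (j ≠ 0 ∧ fld 2 k j ≠ 0 ∧
          (fld 2 k (j - 1) = fld 2 k j - 1 ∨
          (fld 2 k (j - 1) = 1 ∧ fld 2 k j - 1 = 6) ∨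
          (fld 2 k (j - 1) = 6 ∧ fld 2 k j - 1 = 1))) := by
        unfold fld
        split_ifs <;> omega
      unfold lft
      rcases this with ⟨h, hpp⟩ | ⟨h, hpp, hdd⟩
      · rw [if_pos h, if_pos hpp]
      · rw [if_neg h, if_neg hpp]
        beta_reduce
        rcases hdd with h | ⟨h, hpp⟩ | ⟨h, hpp⟩
        · rw [h]
        · rw [h, hpp, hk.1]
        · rw [h, hpp, hk.1]
    have e4 : rgt (N + 5 * k) (fun j => ent T (fld m l i) (fld 2 k j)) j =
        rgt (N + 5) (ent T (fld m l i)) (fld 2 k j) := by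
      have : (j + 1 = N + 5 * k ∧ fld 2 k j + 1 = N + 5) ∨
          (j + 1 ≠ N + 5 * k ∧ fld 2 k j + 1 ≠ N + 5 ∧
          (fld 2 k (j + 1) = fld 2 k j + 1 ∨
          (fld 2 k (j + 1) = 2 ∧ fld 2 k j + 1 = 7) ∨
          (fld 2 k (j + 1) = 7 ∧ fld 2 k j + 1 = 2))) := by
        unfold fld
        split_ifs <;> omega
      unfold rgt
      rcases this with ⟨h, hpp⟩ | ⟨h, hpp, hdd⟩
      · rw [if_pos h, if_pos hpp]
      · rw [if_neg h, if_neg hpp]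
        beta_reduce
        rcases hdd with h | ⟨h, hpp⟩ | ⟨h, hpp⟩
        · rw [h]
        · rw [h, hpp, hk.2]
        · rw [h, hpp, hk.2]
    rw [e1, e2, e3, e4]
    exact hc
  · have hrowsum : ∀ i, ∑ j ∈ range (N + 5 * k), ent T i (fld 2 k j) =
        wOut N T i + k * wIn T i := by
      intro i
      rw [show N + 5 * k = 2 + 5 * k + (N - 2) by omega, sum_fld, wOut, wIn, sm_eq, sm_eq, sm_eq]
      ring
    simp only [hrowsum]
    have := sum_fld (fun i => wOut N T i + k * wIn T i) m 0 l
    rw [add_zero] at this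
    rw [this]
    simp only [sum_add_distrib, ← mul_sum, ← sm_eq]
    simp only [sm_eq _ 0, range_zero, sum_empty, mul_zero, add_zero]
    gcongr

/-- Bounds for the family `m = 5 + 5 l`, one table for each residue of `n`. -/
theorem family5 (l k : ℕ) :
    gammaKR (cylGrid (5 + 5 * l) (4 + 5 * k)) 2 ≤ 16 + k * 15 + l * (16 + k * 15) ∧
    gammaKR (cylGrid (5 + 5 * l) (5 + 5 * k)) 2 ≤ 19 + k * 15 + l * (19 + k * 15) ∧
    gammaKR (cylGrid (5 + 5 * l) (6 + 5 * k)) 2 ≤ 22 + k * 15 + l * (22 + k * 15) ∧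
    gammaKR (cylGrid (5 + 5 * l) (7 + 5 * k)) 2 ≤ 25 + k * 15 + l * (25 + k * 15) ∧
    gammaKR (cylGrid (5 + 5 * l) (8 + 5 * k)) 2 ≤ 28 + k * 15 + l * (28 + k * 15) :=
  ⟨table_bound 5 4 l k 16 15 16 15
      [300003, 30000300, 200030002, 3000030, 300003000, 300003, 30000300, 200030002, 3000030, 300003000]
      (by norm_num) (by norm_num) (by decide +kernel),
   table_bound 5 5 l k 19 15 19 15
      [2000300003, 30000300, 3000030002, 3000030, 300003000, 2000300003, 30000300, 3000030002, 3000030, 300003000]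
      (by norm_num) (by norm_num) (by decide +kernel),
   table_bound 5 6 l k 22 15 22 15
      [30000300003, 30000300, 3000030002, 20003000030, 300003000, 30000300003, 30000300, 3000030002, 20003000030, 300003000]
      (by norm_num) (by norm_num) (by decide +kernel),
   table_bound 5 7 l k 25 15 25 15
      [30000300003, 200030000300, 3000030002, 300003000030, 300003000, 30000300003, 200030000300, 3000030002, 300003000030, 300003000]
      (by norm_num) (by norm_num) (by decide +kernel),
   table_bound 5 8 l k 28 15 28 15
      [30000300003, 3000030000300, 3000030002, 300003000030, 2000300003000, 30000300003, 3000030000300, 3000030002, 300003000030, 2000300003000]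
      (by norm_num) (by norm_num) (by decide +kernel)⟩

/-- Bounds for the family `m = 6 + 5 l`, one table for each residue of `n`. -/
theorem family6 (l k : ℕ) :
    gammaKR (cylGrid (6 + 5 * l) (4 + 5 * k)) 2 ≤ 23 + k * 22 + l * (16 + k * 15) ∧
    gammaKR (cylGrid (6 + 5 * l) (5 + 5 * k)) 2 ≤ 29 + k * 22 + l * (19 + k * 15) ∧
    gammaKR (cylGrid (6 + 5 * l) (6 + 5 * k)) 2 ≤ 35 + k * 22 + l * (22 + k * 15) ∧
    gammaKR (cylGrid (6 + 5 * l) (7 + 5 * k)) 2 ≤ 33 + k * 22 + l * (25 + k * 15) ∧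
    gammaKR (cylGrid (6 + 5 * l) (8 + 5 * k)) 2 ≤ 39 + k * 22 + l * (28 + k * 15) :=
  ⟨table_bound 6 4 l k 23 22 16 15
      [300003, 30300300, 30000300, 200030003, 3000030, 300003000, 300003, 30000300, 200030002, 3000030, 300003000]
      (by norm_num) (by norm_num) (by decide +kernel),
   table_bound 6 5 l k 29 22 19 15
      [2000300003, 230300300, 30000300, 3000030003, 3000030, 300003000, 2000300003, 30000300, 3000030002, 3000030, 300003000]
      (by norm_num) (by norm_num) (by decide +kernel),
   table_bound 6 6 l k 35 22 22 15
      [30000300003, 30300300, 3030000300, 3000030003, 20003000030, 300003000, 30000300003, 30000300, 3000030002, 20003000030, 300003000]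
      (by norm_num) (by norm_num) (by decide +kernel),
   table_bound 6 7 l k 33 22 25 15
      [30000300003, 30030300300, 200030000300, 3000030003, 300003000030, 300003000, 30000300003, 200030000300, 3000030002, 300003000030, 300003000]
      (by norm_num) (by norm_num) (by decide +kernel),
   table_bound 6 8 l k 39 22 28 15
      [30000300003, 2030030300300, 3000030000300, 3000030003, 300003000030, 2000300003000, 30000300003, 3000030000300, 3000030002, 300003000030, 2000300003000]
      (by norm_num) (by norm_num) (by decide +kernel)⟩

/-- Bounds for the family `m = 7 + 5 l`, one table for each residue of `n`. -/
theorem family7 (l k : ℕ) :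
    gammaKR (cylGrid (7 + 5 * l) (4 + 5 * k)) 2 ≤ 26 + k * 25 + l * (16 + k * 15) ∧
    gammaKR (cylGrid (7 + 5 * l) (5 + 5 * k)) 2 ≤ 32 + k * 25 + l * (19 + k * 15) ∧
    gammaKR (cylGrid (7 + 5 * l) (6 + 5 * k)) 2 ≤ 38 + k * 25 + l * (22 + k * 15) ∧
    gammaKR (cylGrid (7 + 5 * l) (7 + 5 * k)) 2 ≤ 39 + k * 25 + l * (25 + k * 15) ∧
    gammaKR (cylGrid (7 + 5 * l) (8 + 5 * k)) 2 ≤ 45 + k * 25 + l * (28 + k * 15) :=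
  ⟨table_bound 7 4 l k 26 25 16 15
      [300003, 30020300, 302003, 330000300, 30002, 3000030, 300003000, 300003, 30000300, 200030002, 3000030, 300003000]
      (by norm_num) (by norm_num) (by decide +kernel),
   table_bound 7 5 l k 32 25 19 15
      [2000300003, 30020300, 3000302003, 30000300, 3000030002, 3000030, 300003000, 2000300003, 30000300, 3000030002, 3000030, 300003000]
      (by norm_num) (by norm_num) (by decide +kernel),
   table_bound 7 6 l k 38 25 22 15
      [30000300003, 30020300, 3200302003, 30000300, 33000030002, 3000030, 300003000, 30000300003, 30000300, 3000030002, 20003000030, 300003000]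
      (by norm_num) (by norm_num) (by decide +kernel),
   table_bound 7 7 l k 39 25 25 15
      [30000300003, 2030020300, 300200302003, 20030000300, 3000030002, 300003000030, 300003000, 30000300003, 200030000300, 3000030002, 300003000030, 300003000]
      (by norm_num) (by norm_num) (by decide +kernel),
   table_bound 7 8 l k 45 25 28 15
      [30000300003, 3002030020300, 30200302003, 3000030000300, 3000030002, 300003000030, 2000300003000, 30000300003, 3000030000300, 3000030002, 300003000030, 2000300003000]
      (by norm_num) (by norm_num) (by decide +kernel)⟩

/-- Bounds for the family `m = 8 + 5 l`, one table for each residue of `n`. -/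
theorem family8 (l k : ℕ) :
    gammaKR (cylGrid (8 + 5 * l) (4 + 5 * k)) 2 ≤ 28 + k * 28 + l * (16 + k * 15) ∧
    gammaKR (cylGrid (8 + 5 * l) (5 + 5 * k)) 2 ≤ 34 + k * 28 + l * (19 + k * 15) ∧
    gammaKR (cylGrid (8 + 5 * l) (6 + 5 * k)) 2 ≤ 40 + k * 28 + l * (22 + k * 15) ∧
    gammaKR (cylGrid (8 + 5 * l) (7 + 5 * k)) 2 ≤ 44 + k * 28 + l * (25 + k * 15) ∧
    gammaKR (cylGrid (8 + 5 * l) (8 + 5 * k)) 2 ≤ 50 + k * 28 + l * (28 + k * 15) :=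
  ⟨table_bound 8 4 l k 28 28 16 15
      [300003, 30020300, 2003020, 300300002, 30000300, 200030002, 3000030, 300003000, 300003, 30000300, 200030002, 3000030, 300003000]
      (by norm_num) (by norm_num) (by decide +kernel),
   table_bound 8 5 l k 34 28 19 15
      [2000300003, 30020300, 2002003020, 200300002, 30000300, 3000030002, 3000030, 300003000, 2000300003, 30000300, 3000030002, 3000030, 300003000]
      (by norm_num) (by norm_num) (by decide +kernel),
   table_bound 8 6 l k 40 28 22 15
      [30000300003, 2030020300, 302003020, 30000300002, 30000300, 3000030002, 20003000030, 300003000, 30000300003, 30000300, 3000030002, 20003000030, 300003000]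
      (by norm_num) (by norm_num) (by decide +kernel),
   table_bound 8 7 l k 44 28 25 15
      [30000300003, 2030020300, 300302003020, 30000300002, 200030000300, 3000030002, 300003000030, 300003000, 30000300003, 200030000300, 3000030002, 300003000030, 300003000]
      (by norm_num) (by norm_num) (by decide +kernel),
   table_bound 8 8 l k 50 28 28 15
      [30000300003, 2002030020300, 200302003020, 30000300002, 3000030000300, 3000030002, 300003000030, 2000300003000, 30000300003, 3000030000300, 3000030002, 300003000030, 2000300003000]
      (by norm_num) (by norm_num) (by decide +kernel)⟩

/-- Bounds for the family `m = 4 + 5 l`, one table for each residue of `n`. -/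
theorem family4 (l k : ℕ) :
    gammaKR (cylGrid (4 + 5 * l) (4 + 5 * k)) 2 ≤ 12 + k * 15 + l * (16 + k * 15) ∧
    gammaKR (cylGrid (4 + 5 * l) (5 + 5 * k)) 2 ≤ 15 + k * 15 + l * (19 + k * 15) ∧
    gammaKR (cylGrid (4 + 5 * l) (6 + 5 * k)) 2 ≤ 18 + k * 15 + l * (22 + k * 15) ∧
    gammaKR (cylGrid (4 + 5 * l) (7 + 5 * k)) 2 ≤ 21 + k * 15 + l * (25 + k * 15) ∧
    gammaKR (cylGrid (4 + 5 * l) (8 + 5 * k)) 2 ≤ 24 + k * 15 + l * (28 + k * 15) :=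
  ⟨table_bound 4 4 l k 12 15 16 15
      [300003, 30030300, 3000030, 300003000, 300003, 30000300, 200030002, 3000030, 300003000]
      (by norm_num) (by norm_num) (by decide +kernel),
   table_bound 4 5 l k 15 15 19 15
      [300003000, 30300303, 3000030000, 3000030, 300003000, 2000300003, 30000300, 3000030002, 3000030]
      (by norm_num) (by norm_num) (by decide +kernel),
   table_bound 4 6 l k 18 15 22 15
      [30000300003, 30030300, 3003000030, 300003000, 30000300003, 30000300, 3000030002, 20003000030, 300003000]
      (by norm_num) (by norm_num) (by decide +kernel),
   table_bound 4 7 l k 21 15 25 15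
      [30000300003, 3030030300, 300003000030, 300003000, 30000300003, 200030000300, 3000030002, 300003000030, 300003000]
      (by norm_num) (by norm_num) (by decide +kernel),
   table_bound 4 8 l k 24 15 28 15
      [30000300003, 2000030000300, 203003030030, 2000300003000, 30000300003, 3000030000300, 3000030002, 300003000030, 2000300003000]
      (by norm_num) (by norm_num) (by decide +kernel)⟩

/-- Bounds for the family `m = 3`, used only without inserted rows, one table for each residue of `n`. -/
theorem family3 (k : ℕ) :
    gammaKR (cylGrid (3 + 5 * 0) (4 + 5 * k)) 2 ≤ 12 + k * 13 + 0 * (500 + k * 500) ∧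
    gammaKR (cylGrid (3 + 5 * 0) (5 + 5 * k)) 2 ≤ 15 + k * 13 + 0 * (500 + k * 500) ∧
    gammaKR (cylGrid (3 + 5 * 0) (6 + 5 * k)) 2 ≤ 18 + k * 13 + 0 * (500 + k * 500) ∧
    gammaKR (cylGrid (3 + 5 * 0) (7 + 5 * k)) 2 ≤ 19 + k * 13 + 0 * (500 + k * 500) ∧
    gammaKR (cylGrid (3 + 5 * 0) (8 + 5 * k)) 2 ≤ 22 + k * 13 + 0 * (500 + k * 500) :=
  ⟨table_bound 3 4 0 k 12 13 500 500
      [22000220, 20030200, 200202003, 22000220, 333333333, 333333333, 333333333, 200202003]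
      (by norm_num) (by norm_num) (by decide +kernel),
   table_bound 3 5 0 k 15 13 500 500
      [22000220, 20030200, 3200202003, 22000220, 3333333333, 3333333333, 3333333333, 3200202003]
      (by norm_num) (by norm_num) (by decide +kernel),
   table_bound 3 6 0 k 18 13 500 500
      [2022000220, 30020030200, 200202003, 2022000220, 33333333333, 33333333333, 33333333333, 200202003]
      (by norm_num) (by norm_num) (by decide +kernel),
   table_bound 3 7 0 k 19 13 500 500
      [20022000220, 3020030200, 300200202003, 20022000220, 333333333333, 333333333333, 333333333333, 300200202003]
      (by norm_num) (by norm_num) (by decide +kernel),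
   table_bound 3 8 0 k 22 13 500 500
      [200022000220, 3003020030200, 20200202003, 200022000220, 3333333333333, 3333333333333, 3333333333333, 20200202003]
      (by norm_num) (by norm_num) (by decide +kernel)⟩

theorem floor_fifth (n : ℕ) : ⌊((n : ℚ) - 2) / 5⌋ = ((n : ℤ) - 2) / 5 := by
  rw [Int.floor_eq_iff]
  have h1 := Int.mul_ediv_add_emod ((n : ℤ) - 2) 5
  have h2 := Int.emod_nonneg ((n : ℤ) - 2) (show (5 : ℤ) ≠ 0 by norm_num)
  have h3 := Int.emod_lt_of_pos ((n : ℤ) - 2) (show (0 : ℤ) < 5 by norm_num)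
  have h4 : 5 * (((n : ℤ) - 2) / 5) ≤ (n : ℤ) - 2 := by omega
  have h5 : (n : ℤ) - 2 < 5 * (((n : ℤ) - 2) / 5) + 5 := by omega
  have hq4 : (5 : ℚ) * ((((n : ℤ) - 2) / 5 : ℤ) : ℚ) ≤ (n : ℚ) - 2 := by exact_mod_cast h4
  have hq5 : (n : ℚ) - 2 < 5 * ((((n : ℤ) - 2) / 5 : ℤ) : ℚ) + 5 := by exact_mod_cast h5
  constructor <;> linarith

/-- Every `n ≥ 4` is `r + 5 k` with `4 ≤ r ≤ 8`. -/
theorem split_n (n : ℕ) (hn : 4 ≤ n) : ∃ k, n = 4 + 5 * k ∨ n = 5 + 5 * k ∨ n = 6 + 5 * k ∨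
    n = 7 + 5 * k ∨ n = 8 + 5 * k := ⟨(n - 4) / 5, by omega⟩


theorem doubleRoman_mod5 (m n : ℕ) (hm : 3 ≤ m) (hn : 4 ≤ n) :
    (m % 5 = 0 →
      (gammaKR (cylGrid m n) 2 : ℤ) ≤ ((m : ℤ) / 5) * (3 * (n : ℤ) + 4)) ∧
    (m % 5 = 1 →
      (gammaKR (cylGrid m n) 2 : ℤ) ≤
        (((m : ℤ) + 4) / 5) * (3 * (n : ℤ) + 4) - 9 - 8 * ⌊((n : ℚ) - 2) / 5⌋) ∧
    (m % 5 = 2 →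
      (gammaKR (cylGrid m n) 2 : ℤ) ≤
        (((m : ℤ) + 3) / 5) * (3 * (n : ℤ) + 4) - 6 - 5 * ⌊((n : ℚ) - 2) / 5⌋) ∧
    (m % 5 = 3 →
      (gammaKR (cylGrid m n) 2 : ℤ) ≤
        (((m : ℤ) + 2) / 5) * (3 * (n : ℤ) + 4) - 4 - 2 * ⌊((n : ℚ) - 2) / 5⌋) ∧
    (m % 5 = 4 →
      (gammaKR (cylGrid m n) 2 : ℤ) ≤
        (((m : ℤ) + 1) / 5) * (3 * (n : ℤ) + 4) - 4) := by
  rw [floor_fifth]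
  obtain ⟨k, hk⟩ := split_n n hn
  refine ⟨fun h => ?_, fun h => ?_, fun h => ?_, fun h => ?_, fun h => ?_⟩
  · obtain ⟨l, rfl⟩ : ∃ l, m = 5 + 5 * l := ⟨(m - 5) / 5, by omega⟩
    rw [show ((5 + 5 * l : ℕ) : ℤ) / 5 = l + 1 by omega]
    obtain ⟨h4, h5, h6, h7, h8⟩ := family5 l k
    rcases hk with rfl | rfl | rfl | rfl | rfl <;> zify at h4 h5 h6 h7 h8 <;> push_cast <;> linarith
  · obtain ⟨l, rfl⟩ : ∃ l, m = 6 + 5 * l := ⟨(m - 6) / 5, by omega⟩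
    rw [show (((6 + 5 * l : ℕ) : ℤ) + 4) / 5 = l + 2 by omega]
    obtain ⟨h4, h5, h6, h7, h8⟩ := family6 l k
    obtain ⟨f, hf⟩ : ∃ f, f = ((n : ℤ) - 2) / 5 := ⟨_, rfl⟩
    rw [← hf]
    rcases hk with rfl | rfl | rfl | rfl | rfl <;> zify at h4 h5 h6 h7 h8 <;> push_cast
    · obtain rfl : f = k := by omega
      linarith
    · obtain rfl : f = k := by omega
      linarith
    · obtain rfl : f = k := by omega
      linarith
    · obtain rfl : f = k + 1 := by omega
      linarith
    · obtain rfl : f = k + 1 := by omega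
      linarith
  · obtain ⟨l, rfl⟩ : ∃ l, m = 7 + 5 * l := ⟨(m - 7) / 5, by omega⟩
    rw [show (((7 + 5 * l : ℕ) : ℤ) + 3) / 5 = l + 2 by omega]
    obtain ⟨h4, h5, h6, h7, h8⟩ := family7 l k
    obtain ⟨f, hf⟩ : ∃ f, f = ((n : ℤ) - 2) / 5 := ⟨_, rfl⟩
    rw [← hf]
    rcases hk with rfl | rfl | rfl | rfl | rfl <;> zify at h4 h5 h6 h7 h8 <;> push_cast
    · obtain rfl : f = k := by omega
      linarith
    · obtain rfl : f = k := by omega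
      linarith
    · obtain rfl : f = k := by omega
      linarith
    · obtain rfl : f = k + 1 := by omega
      linarith
    · obtain rfl : f = k + 1 := by omega
      linarith
  · obtain ⟨f, hf⟩ : ∃ f, f = ((n : ℤ) - 2) / 5 := ⟨_, rfl⟩
    rw [← hf]
    by_cases h3 : m = 3
    · subst h3
      rw [show (((3 : ℕ) : ℤ) + 2) / 5 = 1 by norm_num]
      obtain ⟨h4, h5, h6, h7, h8⟩ := family3 k
      simp only [add_zero, zero_mul] at h4 h5 h6 h7 h8
      rcases hk with rfl | rfl | rfl | rfl | rfl <;> zify at h4 h5 h6 h7 h8 <;> push_cast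
      · obtain rfl : f = k := by omega
        linarith
      · obtain rfl : f = k := by omega
        linarith
      · obtain rfl : f = k := by omega
        linarith
      · obtain rfl : f = k + 1 := by omega
        linarith
      · obtain rfl : f = k + 1 := by omega
        linarith
    · obtain ⟨l, rfl⟩ : ∃ l, m = 8 + 5 * l := ⟨(m - 8) / 5, by omega⟩
      rw [show (((8 + 5 * l : ℕ) : ℤ) + 2) / 5 = l + 2 by omega]
      obtain ⟨h4, h5, h6, h7, h8⟩ := family8 l k
      rcases hk with rfl | rfl | rfl | rfl | rfl <;> zify at h4 h5 h6 h7 h8 <;> push_cast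
      · obtain rfl : f = k := by omega
        linarith
      · obtain rfl : f = k := by omega
        linarith
      · obtain rfl : f = k := by omega
        linarith
      · obtain rfl : f = k + 1 := by omega
        linarith
      · obtain rfl : f = k + 1 := by omega
        linarith
  · obtain ⟨l, rfl⟩ : ∃ l, m = 4 + 5 * l := ⟨(m - 4) / 5, by omega⟩
    rw [show (((4 + 5 * l : ℕ) : ℤ) + 1) / 5 = l + 1 by omega]
    obtain ⟨h4, h5, h6, h7, h8⟩ := family4 l k
    rcases hk with rfl | rfl | rfl | rfl | rfl <;> zify at h4 h5 h6 h7 h8 <;> push_cast <;> linarith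
end
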